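/- Let G be a finite simple graph that is (K₂ ∪ 2K₁)-free, has maximum degree Δ(G) ≥ 9 and chromatic number χ(G) > max{ω(G), Δ(G) − 1}, and has the minimum number of vertices among all (K₂ ∪ 2K₁)-free graphs with these properties. Then χ(G) = Δ(G) > ω(G), and for every vertex u of G one has χ(G − u) = Δ(G) − 1 and deg(u) ≥ Δ(G) − 1. -/

import Mathlib

open SimpleGraph

/-- The graph `H = P₃ ∪ K₁`: a path 0–1–2 together with the isolated vertex 3. -/
def graphH : SimpleGraph (Fin 4) := SimpleGraph.fromEdgeSet {s(0, 1), s(1, 2)}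

/-- The graph `R = K₂ ∪ 2K₁`: the edge 0–1 together with the isolated vertices 2 and 3. -/
def graphR : SimpleGraph (Fin 4) := SimpleGraph.fromEdgeSet {s(0, 1)}

/-- `G` contains no induced subgraph isomorphic to `F`
(graph embeddings are exactly induced-subgraph copies). -/
def IndFree {α : Type*} {V : Type*} (F : SimpleGraph α) (G : SimpleGraph V) : Prop :=
  IsEmpty (F ↪g G)

/-- Maximum degree `Δ(G)` (with classical decidability of adjacency). -/
noncomputable def maxDeg {V : Type*} [Fintype V] (G : SimpleGraph V) : ℕ := by
  classical exact G.maxDegree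

/-- Degree of a vertex (with classical decidability of adjacency). -/
noncomputable def deg {V : Type*} [Fintype V] (G : SimpleGraph V) (v : V) : ℕ := by
  classical exact G.degree v

namespace SimpleGraph

/-- The vertices in `s` admit a proper colouring of the graph they induce with `k` colours. -/
def ColorableOn {V : Type*} (G : SimpleGraph V) (s : Finset V) (k : ℕ) : Prop :=
  ∃ f : V → ℕ, (∀ x ∈ s, f x < k) ∧ ∀ x ∈ s, ∀ y ∈ s, G.Adj x y → f x ≠ f y

variable {V : Type*} {G : SimpleGraph V} {k : ℕ}

theorem ColorableOn.colorable [Fintype V] (h : G.ColorableOn Finset.univ k) : G.Colorable k := by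
  obtain ⟨f, hk, hf⟩ := h
  exact ⟨Coloring.mk (fun v ↦ ⟨f v, hk v (Finset.mem_univ v)⟩) fun {v w} hvw h ↦
    hf v (Finset.mem_univ v) w (Finset.mem_univ w) hvw (congrArg Fin.val h)⟩

open Classical in
theorem ColorableOn.insert_of_forall_exists {s : Finset V} {v : V} {f : V → ℕ}
    (hk : ∀ x ∈ s, f x < k) (hf : ∀ x ∈ s, ∀ y ∈ s, G.Adj x y → f x ≠ f y) {c : ℕ} (hc : c < k)
    (hv : ∀ w ∈ s, G.Adj v w → f w ≠ c) : G.ColorableOn (insert v s) k := by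
  by_cases hvs : v ∈ s
  · rw [Finset.insert_eq_of_mem hvs]
    exact ⟨f, hk, hf⟩
  refine ⟨Function.update f v c, ?_, ?_⟩
  · intro x hx
    by_cases h : x = v <;> grind
  · intro x hx y hy hxy
    have := hxy.symm
    have := hxy.ne
    by_cases h : x = v <;> by_cases h' : y = v <;> grind

open Classical in
theorem ColorableOn.insert_of_card_lt {s : Finset V} (hs : G.ColorableOn s k) {v : V}
    (hv : (s.filter (G.Adj v)).card < k) : G.ColorableOn (insert v s) k := by
  obtain ⟨f, hk, hf⟩ := hs
  obtain ⟨c, hc, hc'⟩ := Finset.exists_mem_notMem_of_card_lt_card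
    (s := (s.filter (G.Adj v)).image f) (t := Finset.range k)
    (Finset.card_image_le.trans_lt (by simpa using hv))
  refine insert_of_forall_exists hk hf (Finset.mem_range.1 hc) fun w hw hvw h ↦ hc' ?_
  exact Finset.mem_image.2 ⟨w, Finset.mem_filter.2 ⟨hw, hvw⟩, h⟩

open Classical in
theorem colorableOn_of_forall_card_lt {s : Finset V}
    (hs : ∀ v ∈ s, (s.filter (G.Adj v)).card < k) : G.ColorableOn s k := by
  induction s using Finset.induction_on with
  | empty => exact ⟨fun _ ↦ 0, by simp, by simp⟩
  | insert v s hvs ih =>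
    refine (ih fun w hw ↦ ?_).insert_of_card_lt ?_
    · exact (Finset.card_le_card (Finset.filter_subset_filter _ (Finset.subset_insert v s))).trans_lt
        (hs w (Finset.mem_insert_of_mem hw))
    · exact (Finset.card_le_card (Finset.filter_subset_filter _ (Finset.subset_insert v s))).trans_lt
        (hs v (Finset.mem_insert_self v s))

theorem ColorableOn.union_of_isIndepSet [DecidableEq V] {s I : Finset V} (hs : G.ColorableOn s k)
    (hI : G.IsIndepSet I) : G.ColorableOn (s ∪ I) (k + 1) := by
  classical
  obtain ⟨f, hk, hf⟩ := hs
  refine ⟨fun x ↦ if x ∈ I then k else f x, ?_, ?_⟩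
  · intro x hx
    have := hk x
    grind
  · intro x hx y hy hxy
    have h1 : x ∈ I → y ∈ I → False := fun hx hy ↦ hI hx hy hxy.ne hxy
    have := hf x
    have := hk x
    have := hk y
    grind

theorem ColorableOn.of_induce [Fintype V] [DecidableEq V] {u : V}
    (h : (G.induce {u}ᶜ).Colorable k) : G.ColorableOn (Finset.univ.erase u) k := by
  classical
  obtain ⟨C⟩ := h
  refine ⟨fun x ↦ if hx : x = u then 0 else (C ⟨x, hx⟩ : ℕ), ?_, ?_⟩
  · intro x hx
    simp [Finset.ne_of_mem_erase hx]
  · intro x hx y hy hxy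
    have := C.valid (v := ⟨x, Finset.ne_of_mem_erase hx⟩) (w := ⟨y, Finset.ne_of_mem_erase hy⟩) hxy
    simpa [Finset.ne_of_mem_erase hx, Finset.ne_of_mem_erase hy, Fin.ext_iff] using this

/-- A vertex `v` with `k` neighbours `N` and `k` non-neighbours `A`, in a graph of maximum degree
at most `k` without three independent vertices, forces a clique on `k + 1` vertices. -/
theorem not_cliqueFree_of_card_eq (hk3 : 3 ≤ k)
    (hdeg : ∀ v, ∀ t : Finset V, (∀ w ∈ t, G.Adj v w) → t.card ≤ k)
    (hα : ∀ x y z, x ≠ y → x ≠ z → y ≠ z → G.Adj x y ∨ G.Adj x z ∨ G.Adj y z)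
    {v : V} {N A : Finset V} (hNcard : N.card = k) (hAcard : A.card = k) (hNA : Disjoint N A)
    (hNv : v ∉ N) (hAv : v ∉ A) (hvN : ∀ w ∈ N, G.Adj v w) (hvA : ∀ w ∈ A, ¬ G.Adj v w) :
    ¬ G.CliqueFree (k + 1) := by
  classical
  intro hcl
  have hcl' : ∀ t : Finset V, t.card = k + 1 → (∀ x ∈ t, ∀ y ∈ t, x ≠ y → G.Adj x y) → False :=
    fun t ht h ↦ hcl t ⟨fun x hx y hy ↦ h x hx y hy, ht⟩
  clear hcl
  have hins : ∀ x, ∀ T : Finset V, (∀ y ∈ T, ∀ z ∈ T, y ≠ z → G.Adj y z) → (∀ y ∈ T, G.Adj x y) →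
      ∀ y ∈ insert x T, ∀ z ∈ insert x T, y ≠ z → G.Adj y z := by
    intro x T hT hxT y hy z hz hyz
    rcases Finset.mem_insert.1 hy with rfl | hyT <;> rcases Finset.mem_insert.1 hz with rfl | hzT
    · exact (hyz rfl).elim
    · exact hxT z hzT
    · exact (hxT y hyT).symm
    · exact hT y hyT z hzT hyz
  have hne : ∀ b ∈ N, ∀ x ∈ A, b ≠ x := fun b hb x hx h ↦ Finset.disjoint_left.1 hNA hb (h ▸ hx)
  have hAadj : ∀ x ∈ A, ∀ y ∈ A, x ≠ y → G.Adj x y := by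
    intro x hx y hy hxy
    have := hα v x y (fun h ↦ hAv (h ▸ hx)) (fun h ↦ hAv (h ▸ hy)) hxy
    have := hvA x hx
    have := hvA y hy
    tauto
  have hone : ∀ x ∈ A, ∀ b ∈ N, ∀ b' ∈ N, G.Adj x b → G.Adj x b' → b = b' := by
    intro x hx b hb b' hb' h h'
    by_contra hbb'
    have hbA : b ∉ A := fun h ↦ hne b hb b h rfl
    have hbA' : b' ∉ A := fun h ↦ hne b' hb' b' h rfl
    have := hdeg x (insert b (insert b' (A.erase x))) (by
      simp only [Finset.mem_insert, Finset.mem_erase]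
      rintro w (rfl | rfl | ⟨hwx, hw⟩)
      exacts [h, h', hAadj x hx w hw hwx.symm])
    rw [Finset.card_insert_of_notMem (by simp [hbb', hbA]),
      Finset.card_insert_of_notMem (by simp [hbA']), Finset.card_erase_of_mem hx] at this
    omega
  have hfull : ∀ b ∈ N, ∃ x ∈ A, ¬ G.Adj b x := by
    intro b hb
    by_contra! h
    refine hcl' (insert b A) ?_ (hins b A hAadj h)
    rw [Finset.card_insert_of_notMem fun h ↦ hne b hb b h rfl, hAcard]
  obtain ⟨b, hb, b', hb', hbb', hadj⟩ : ∃ b ∈ N, ∃ b' ∈ N, b ≠ b' ∧ ¬ G.Adj b b' := by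
    by_contra! h
    refine hcl' (insert v N) ?_ (hins v N h hvN)
    rw [Finset.card_insert_of_notMem hNv, hNcard]
  have hcard : ∀ b ∈ N, ∀ b' ∈ N, b ≠ b' → ¬ G.Adj b b' → (A.filter (G.Adj b)).card ≤ 1 := by
    intro b hb b' hb' hbb' hadj
    obtain ⟨x, hx, hbx⟩ := hfull b hb
    have hxb' : G.Adj x b' := by
      have := hα b b' x hbb' (hne b hb x hx) (hne b' hb' x hx)
      have := G.adj_comm x b'
      tauto
    have hall : ∀ c ∈ N, c ≠ b → c ≠ b' → G.Adj b c := by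
      intro c hc hcb hcb'
      have := hα b c x hcb.symm (hne b hb x hx) (hne c hc x hx)
      have := fun h ↦ hcb' (hone x hx b' hb' c hc hxb' h).symm
      have := G.adj_comm x c
      tauto
    have := hdeg b (insert v ((N.erase b).erase b' ∪ A.filter (G.Adj b))) (by
      simp only [Finset.mem_insert, Finset.mem_union, Finset.mem_erase, Finset.mem_filter]
      rintro w (rfl | ⟨hw, hw', hwN⟩ | ⟨-, hw⟩)
      exacts [(hvN b hb).symm, hall w hwN hw' hw, hw])
    rw [Finset.card_insert_of_notMem (by simp [hNv, hAv]), Finset.card_union_of_disjoint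
      (hNA.mono ((Finset.erase_subset _ _).trans (Finset.erase_subset _ _))
        (Finset.filter_subset _ _)), Finset.card_erase_of_mem (by simp [hb', hbb'.symm]),
      Finset.card_erase_of_mem hb] at this
    omega
  have h1 := hcard b hb b' hb' hbb' hadj
  have h2 := hcard b' hb' b hb hbb'.symm fun h ↦ hadj h.symm
  have h3 : A ⊆ A.filter (G.Adj b) ∪ A.filter (G.Adj b') := by
    intro x hx
    have := hα b b' x hbb' (hne b hb x hx) (hne b' hb' x hx)
    simp only [Finset.mem_union, Finset.mem_filter]
    tauto
  have h4 := (Finset.card_le_card h3).trans (Finset.card_union_le _ _)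
  omega

/-- The inductive step in Brooks' theorem for graphs without three independent vertices. -/
theorem ColorableOn.insert_of_no_indep_triple (hk3 : 3 ≤ k)
    (hdeg : ∀ v, ∀ t : Finset V, (∀ w ∈ t, G.Adj v w) → t.card ≤ k) (hcl : G.CliqueFree (k + 1))
    (hα : ∀ x y z, x ≠ y → x ≠ z → y ≠ z → G.Adj x y ∨ G.Adj x z ∨ G.Adj y z)
    [DecidableEq V] {s : Finset V} {v : V} (hs : G.ColorableOn s k) (hvs : v ∉ s) :
    G.ColorableOn (insert v s) k := by
  classical
  by_contra hno
  have hcl' : ∀ t : Finset V, t.card = k + 1 → (∀ x ∈ t, ∀ y ∈ t, x ≠ y → G.Adj x y) → False :=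
    fun t ht h ↦ hcl t ⟨fun x hx y hy ↦ h x hx y hy, ht⟩
  obtain ⟨f, hk, hf⟩ := hs
  have hsym : ∀ x y, G.Adj x y → G.Adj y x := fun x y h ↦ h.symm
  have hirr : ∀ x, ¬ G.Adj x x := fun x h ↦ h.ne rfl
  set N := s.filter (G.Adj v) with hN
  have hsurj : ∀ c < k, ∃ w ∈ N, f w = c := by
    intro c hc
    by_contra! h
    exact hno (by
      convert insert_of_forall_exists (v := v) hk hf hc fun w hw hvw ↦ h w (by simp [hN, hw, hvw]))
  have hNk : N.card ≤ k := hdeg v N fun w hw ↦ (Finset.mem_filter.1 hw).2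
  have himg : N.image f = Finset.range k := by
    ext c
    constructor
    · intro h
      grind
    · intro h
      obtain ⟨w, hw, rfl⟩ := hsurj c (Finset.mem_range.1 h)
      exact Finset.mem_image_of_mem f hw
  have hNcard : N.card = k :=
    hNk.antisymm (by simpa [himg] using Finset.card_image_le (s := N) (f := f))
  have hinj : ∀ x ∈ N, ∀ y ∈ N, f x = f y → x = y := fun x hx y hy h ↦
    Finset.card_image_iff.1 (by rw [himg, hNcard, Finset.card_range]) hx hy h
  have hNs : ∀ w ∈ N, w ∈ s := fun w hw ↦ (Finset.mem_filter.1 hw).1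
  have hvN : ∀ w ∈ N, G.Adj v w := fun w hw ↦ (Finset.mem_filter.1 hw).2
  have hNc : ∀ w ∈ s, w ∉ N → ¬ G.Adj v w := fun w hw h h' ↦ h (by simp [hN, hw, h'])
  have hNv : v ∉ N := fun h ↦ hvs (hNs v h)
  have hclass : ∀ x ∈ s, ∀ y ∈ s, ∀ z ∈ s, f x = f y → f x = f z → x = y ∨ x = z ∨ y = z := by
    intro x hx y hy z hz hxy hxz
    have := hα x y z
    have := hf x hx y hy
    have := hf x hx z hz
    have := hf y hy z hz
    grind
  have hNclique : (∀ x ∈ N, ∀ y ∈ N, x ≠ y → G.Adj x y) → False := by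
    intro h
    refine hcl' (insert v N) (by rw [Finset.card_insert_of_notMem hNv, hNcard]) ?_
    grind
  by_cases hsing : ∃ p ∈ N, ∀ a ∈ s, f a = f p → a = p
  · obtain ⟨p, hp, hps⟩ := hsing
    have hpN : ∀ b ∈ N, b ≠ p → G.Adj p b := by
      intro b hb hbp
      by_contra hpb
      have hb' : ∀ a ∈ s, f a = f b → a ≠ b → a ∉ N := fun a ha h hne haN ↦ hne (hinj a haN b hb h)
      refine hno ⟨fun x ↦ if x = v then f b else if x = b then f p else f x, ?_, ?_⟩
      · grind
      · intro x hx y hy hxy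
        have := hf x
        have := hxy.symm
        have := hxy.ne
        clear hno hNclique hcl' hcl hdeg hα hsurj himg hclass
        grind
    have hpA : ∀ a ∈ s, a ∉ N → ¬ G.Adj p a := by
      intro a ha haN hpa
      have := hdeg p (insert a (insert v (N.erase p))) (by grind)
      rw [Finset.card_insert_of_notMem (by grind), Finset.card_insert_of_notMem (by grind),
        Finset.card_erase_of_mem hp] at this
      omega
    refine hNclique fun b hb b' hb' hbb' ↦ ?_
    by_contra hadj
    by_cases hbp : b = p
    · exact hadj (hbp ▸ hpN b' hb' (by grind))
    by_cases hbp' : b' = p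
    · exact hadj (hbp' ▸ (hpN b hb (by grind)).symm)
    have hab : ∀ a ∈ s, f a = f b → a ≠ b → a ∉ N := fun a ha h hne haN ↦
      hne (hinj a haN b hb h)
    have hab' : ∀ a ∈ s, f a = f b' → a ≠ b' → a ∉ N := fun a ha h hne haN ↦
      hne (hinj a haN b' hb' h)
    refine hno ⟨fun x ↦ if x = v then f b else if x = b then f b' else
      if f x = f b' ∧ x ≠ b' then f p else f x, ?_, ?_⟩
    · grind
    · intro x hx y hy hxy
      have h1 := hf x
      have h2 := hxy.symm
      have h3 := hxy.ne
      have h4 := hinj b hb b' hb'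
      have h5 := hinj b hb p hp
      have h6 := hinj b' hb' p hp
      have h7 := hclass x
      clear hno hNclique hcl' hcl hdeg hα hsurj himg
      grind
  · push Not at hsing
    choose! a has haf hane using hsing
    have haN : ∀ p ∈ N, a p ∉ N := fun p hp h ↦ hane p hp (hinj _ h p hp (haf p hp))
    obtain ⟨A, hA⟩ : ∃ A, A = N.image a := ⟨_, rfl⟩
    have hAcard : A.card = k := by
      rw [hA, Finset.card_image_of_injOn, hNcard]
      intro p hp q hq h
      exact hinj p hp q hq (by rw [← haf p hp, ← haf q hq, h])
    have hAs : ∀ x ∈ A, x ∈ s ∧ x ∉ N := by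
      intro x hx
      obtain ⟨p, hp, rfl⟩ := Finset.mem_image.1 (hA ▸ hx)
      exact ⟨has p hp, haN p hp⟩
    refine not_cliqueFree_of_card_eq hk3 hdeg hα hNcard hAcard (Finset.disjoint_left.2 fun w h h' ↦
      (hAs w h').2 h) hNv (fun h ↦ hvs (hAs v h).1) hvN (fun w hw ↦ ?_) hcl
    exact hNc w (hAs w hw).1 (hAs w hw).2

theorem colorable_of_no_indep_triple [Fintype V] (hk3 : 3 ≤ k)
    (hdeg : ∀ v, ∀ t : Finset V, (∀ w ∈ t, G.Adj v w) → t.card ≤ k) (hcl : G.CliqueFree (k + 1))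
    (hα : ∀ x y z, x ≠ y → x ≠ z → y ≠ z → G.Adj x y ∨ G.Adj x z ∨ G.Adj y z) :
    G.Colorable k := by
  classical
  refine ColorableOn.colorable ?_
  induction (Finset.univ : Finset V) using Finset.induction_on with
  | empty => exact ⟨fun _ ↦ 0, by simp, by simp⟩
  | insert v s hvs ih => exact ih.insert_of_no_indep_triple hk3 hdeg hcl hα hvs

end SimpleGraph

theorem IndFree.of_embedding {α V W : Type*} {F : SimpleGraph α} {G : SimpleGraph V}
    {H : SimpleGraph W} (h : IndFree F G) (e : H ↪g G) : IndFree F H :=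
  ⟨fun i ↦ h.false (i.trans e)⟩

theorem IndFree.adj_of_adj_of_indep {V : Type*} {G : SimpleGraph V} (h : IndFree graphR G)
    {v w x y : V} (hvw : G.Adj v w) (hxy : x ≠ y) (hxy' : ¬ G.Adj x y) (hwx : w ≠ x) (hwy : w ≠ y)
    (hwx' : ¬ G.Adj w x) (hwy' : ¬ G.Adj w y) (hvx : v ≠ x) (hvy : v ≠ y) :
    G.Adj v x ∨ G.Adj v y := by
  by_contra! hv
  have hne := hvw.ne
  refine h.false ⟨⟨![v, w, x, y], ?_⟩, ?_⟩
  · intro i j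
    fin_cases i <;> fin_cases j <;> simp_all [eq_comm]
  · intro i j
    change G.Adj (![v, w, x, y] i) (![v, w, x, y] j) ↔ _
    obtain ⟨hvx', hvy'⟩ := hv
    have h1 := mt G.adj_symm hvx'
    have h2 := mt G.adj_symm hvy'
    have h3 := mt G.adj_symm hwx'
    have h4 := mt G.adj_symm hwy'
    have h5 := mt G.adj_symm hxy'
    have h6 := hvw.symm
    fin_cases i <;> fin_cases j <;> simp [graphR, *]

open Classical in
theorem IndFree.colorable_of_indep_triple {V : Type*} [Fintype V] {G : SimpleGraph V} {k : ℕ}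
    (hfree : IndFree graphR G) (hk : 1 ≤ k)
    (hdeg : ∀ v, ∀ t : Finset V, (∀ w ∈ t, G.Adj v w) → t.card ≤ k)
    (hα : ∃ I : Finset V, G.IsIndepSet I ∧ 3 ≤ I.card) : G.Colorable k := by
  obtain ⟨I₀, hI₀, hI₀3⟩ := hα
  obtain ⟨I, hI, hmax⟩ := Finset.exists_max_image
    (Finset.univ.filter fun I : Finset V ↦ G.IsIndepSet (I : Set V)) Finset.card
    ⟨I₀, by simpa using hI₀⟩
  simp only [Finset.mem_filter, Finset.mem_univ, true_and] at hI hmax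
  have hI3 : 3 ≤ I.card := hI₀3.trans (hmax I₀ hI₀)
  have hI' : ∀ x ∈ I, ∀ y ∈ I, ¬ G.Adj x y := fun x hx y hy h ↦ hI hx hy h.ne h
  have htwo : ∀ v ∉ I, 2 ≤ (I.filter (G.Adj v)).card := by
    intro v hv
    obtain ⟨w, hw, hvw⟩ : ∃ w ∈ I, G.Adj v w := by
      by_contra! h
      have := hmax (insert v I) (by
        intro x hx y hy hxy hadj
        have := hadj.symm
        simp only [Finset.coe_insert, Set.mem_insert_iff, Finset.mem_coe] at hx hy
        grind)
      rw [Finset.card_insert_of_notMem hv] at this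
      omega
    have hmiss : (I.filter fun x ↦ ¬ G.Adj v x).card ≤ 1 := by
      refine Finset.card_le_one.2 fun x hx y hy ↦ ?_
      by_contra hxy
      simp only [Finset.mem_filter] at hx hy
      have := hfree.adj_of_adj_of_indep hvw hxy (hI' x hx.1 y hy.1) (fun h ↦ hx.2 (h ▸ hvw))
        (fun h ↦ hy.2 (h ▸ hvw)) (hI' w hw x hx.1) (hI' w hw y hy.1) (fun h ↦ hv (h ▸ hx.1))
        (fun h ↦ hv (h ▸ hy.1))
      tauto
    have := Finset.card_filter_add_card_filter_not (s := I) (G.Adj v)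
    omega
  have hs : G.ColorableOn Iᶜ (k - 1) := by
    refine SimpleGraph.colorableOn_of_forall_card_lt fun v hv ↦ ?_
    have h1 := htwo v (by simpa using hv)
    have h2 := hdeg v (Iᶜ.filter (G.Adj v) ∪ I.filter (G.Adj v)) (by grind)
    rw [Finset.card_union_of_disjoint (Finset.disjoint_filter_filter disjoint_compl_left)] at h2
    omega
  have := hs.union_of_isIndepSet hI
  rw [Nat.sub_add_cancel hk, Finset.union_comm, Finset.union_compl] at this
  exact this.colorable

/-- Brooks' theorem for `(K₂ ∪ 2K₁)`-free graphs. -/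
theorem IndFree.colorable_of_maxDeg_le {V : Type*} [Fintype V] {G : SimpleGraph V} {k : ℕ}
    (hfree : IndFree graphR G) (hk : 3 ≤ k) (hdeg : maxDeg G ≤ k) (hcl : G.cliqueNum ≤ k) :
    G.Colorable k := by
  classical
  have hdeg' : ∀ v, ∀ t : Finset V, (∀ w ∈ t, G.Adj v w) → t.card ≤ k := by
    intro v t ht
    have h1 : G.degree v ≤ maxDeg G := by
      unfold maxDeg
      convert G.degree_le_maxDegree v
    have h2 : t ⊆ G.neighborFinset v := fun w hw ↦ (G.mem_neighborFinset v w).2 (ht w hw)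
    exact (Finset.card_le_card h2).trans (h1.trans hdeg)
  by_cases hα : ∃ I : Finset V, G.IsIndepSet I ∧ 3 ≤ I.card
  · exact hfree.colorable_of_indep_triple (by omega) hdeg' hα
  · push Not at hα
    refine colorable_of_no_indep_triple hk hdeg' (fun t ht ↦ ?_) fun x y z hxy hxz hyz ↦ ?_
    · have := ht.isClique.card_le_cliqueNum
      have := ht.card_eq
      omega
    · by_contra! h
      have := hα {x, y, z} (by
        intro a ha b hb hab hadj
        have := hadj.symm
        simp only [Finset.coe_insert, Finset.coe_singleton, Set.mem_insert_iff,
          Set.mem_singleton_iff] at ha hb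
        grind)
      rw [Finset.card_eq_three.2 ⟨x, y, z, hxy, hxz, hyz, rfl⟩] at this
      omega

theorem SimpleGraph.Embedding.cliqueNum_le {V W : Type*} [Fintype V] {G : SimpleGraph V}
    {H : SimpleGraph W} [Fintype W] (e : H ↪g G) : H.cliqueNum ≤ G.cliqueNum := by
  classical
  obtain ⟨t, ht⟩ := H.exists_isNClique_cliqueNum
  have h := ht.map (f := e.toEmbedding)
  have h' := (h.mono (SimpleGraph.map_le_iff_le_comap _ _ _ |>.2 (by
    intro a b hab; exact e.map_rel_iff.2 hab))).isClique.card_le_cliqueNum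
  rwa [Finset.card_map, ht.card_eq] at h'

theorem maxDeg_le_of_embedding {V W : Type*} [Fintype V] [Fintype W] {G : SimpleGraph V}
    {H : SimpleGraph W} (e : H ↪g G) : maxDeg H ≤ maxDeg G := by
  classical
  unfold maxDeg
  refine maxDegree_le_of_forall_degree_le _ _ fun v ↦ le_trans ?_ (G.degree_le_maxDegree (e v))
  refine Finset.card_le_card_of_injOn e (fun w hw ↦ ?_) e.injective.injOn
  simpa using hw

/-- A minimal `(K₂ ∪ 2K₁)`-free counterexample `G` to Borodin–Kostochka (i.e. `Δ(G) ≥ 9`,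
`χ(G) > max {ω(G), Δ(G) - 1}`, with the fewest vertices among all such graphs) satisfies
`χ(G) = Δ(G) > ω(G)`, and for every vertex `u`, `χ(G - u) = Δ(G) - 1` and
`deg u ≥ Δ(G) - 1`. -/
theorem minimal_counterexample_K2_union_2K1_free {V : Type*} [Fintype V] (G : SimpleGraph V)
    (hfree : IndFree graphR G) (hΔ : 9 ≤ maxDeg G)
    (hχ : ((max G.cliqueNum (maxDeg G - 1) : ℕ) : ℕ∞) < G.chromaticNumber)
    (hmin : ∀ (m : ℕ) (G' : SimpleGraph (Fin m)), IndFree graphR G' → 9 ≤ maxDeg G' →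
      ((max G'.cliqueNum (maxDeg G' - 1) : ℕ) : ℕ∞) < G'.chromaticNumber →
      Fintype.card V ≤ m) :
    G.chromaticNumber = (maxDeg G : ℕ∞) ∧ G.cliqueNum < maxDeg G ∧
      ∀ u : V, (G.induce {u}ᶜ).chromaticNumber = ((maxDeg G - 1 : ℕ) : ℕ∞) ∧
        maxDeg G - 1 ≤ deg G u := by
  classical
  have hω : G.cliqueNum < maxDeg G := by
    by_contra! h
    have h1 := (hfree.colorable_of_maxDeg_le (by omega) h le_rfl).chromaticNumber_le
    rw [max_eq_left (by omega)] at hχ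
    exact hχ.not_ge h1
  rw [max_eq_right (by omega)] at hχ
  have hnot : ¬ G.Colorable (maxDeg G - 1) := fun h ↦ hχ.not_ge h.chromaticNumber_le
  have hcol : G.Colorable (maxDeg G) := hfree.colorable_of_maxDeg_le (by omega) le_rfl hω.le
  refine ⟨?_, hω, fun u ↦ ?_⟩
  · refine hcol.chromaticNumber_le.antisymm (le_chromaticNumber_iff_colorable.2 fun m hm ↦ ?_)
    by_contra! h
    exact hnot (hm.mono (by omega))
  let e : G.induce {u}ᶜ ↪g G := Embedding.induce _
  have hfree' := hfree.of_embedding e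
  have hΔ' := maxDeg_le_of_embedding e
  have hω' := e.cliqueNum_le
  have hcol' : (G.induce {u}ᶜ).Colorable (maxDeg G - 1) := by
    rcases Nat.lt_or_ge (maxDeg (G.induce {u}ᶜ)) (maxDeg G) with hlt | hge
    · exact hfree'.colorable_of_maxDeg_le (by omega) (by omega) (by omega)
    · by_contra hnot'
      let i := (G.induce {u}ᶜ).overFinIso rfl
      have h1 := maxDeg_le_of_embedding i.toEmbedding
      have h2 := maxDeg_le_of_embedding i.symm.toEmbedding
      have h3 := i.symm.toEmbedding.cliqueNum_le
      have h4 := hmin _ _ (hfree'.of_embedding i.symm.toEmbedding) (by omega) (by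
        rw [max_eq_right (by omega)]
        by_contra! h
        exact hnot' (((chromaticNumber_le_iff_colorable.1 h).of_hom i.toHom).mono (by omega)))
      have h5 : Fintype.card ({u}ᶜ : Set V) < Fintype.card V :=
        Fintype.card_subtype_lt (x := u) (by simp)
      omega
  have hins : insert u (Finset.univ.erase u) = Finset.univ := Finset.insert_erase (Finset.mem_univ u)
  have hext : ∀ k, (G.induce {u}ᶜ).Colorable k → deg G u < k → G.Colorable k := by
    intro k hk hu
    refine ColorableOn.colorable (hins ▸ (ColorableOn.of_induce hk).insert_of_card_lt ?_)
    refine lt_of_le_of_lt (Finset.card_le_card fun w hw ↦ ?_) hu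
    simpa using (Finset.mem_filter.1 hw).2
  refine ⟨hcol'.chromaticNumber_le.antisymm (le_chromaticNumber_iff_colorable.2 fun m hm ↦ ?_), ?_⟩
  · by_contra! h
    refine hnot (ColorableOn.colorable (k := maxDeg G - 1) ?_)
    have h1 := (ColorableOn.of_induce (hm.mono (by omega : m ≤ maxDeg G - 2))).union_of_isIndepSet
      (I := {u}) (by simp)
    rw [Finset.union_comm, ← Finset.insert_eq, hins] at h1
    convert h1 using 1
    omega
  · by_contra! h
    exact hnot (hext _ hcol' h)
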